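/- arXiv:1407.1905 — 6 statements merged into one kernel-verified Lean document; each statement's English description precedes it below -/
import Mathlib

section
/- Let p be an odd prime and let s be an integer with gcd(s, rn) = 1, s ≡ 1 (mod r) and s ≠ 1. Then there exists a Type I p-adic splitting of 1+rZ_{rn} given by μ_s if and only if p divides gcd(n, r) and ν_p(s−1) < min{ν_p(q−1), ν_p(rn)}. -/
/-- The subset `1 + r·Z_{rn}` of `Z_{rn} = ZMod (r*n)`, i.e. the residues
congruent to `1` modulo `r`. -/
def oneAddRZ (n r : ℕ) : Set (ZMod (r * n)) :=
  {x | ∃ k : ZMod (r * n), x = 1 + (r : ZMod (r * n)) * k}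

/-- `X` is a Type I `m`-adic splitting of `1 + r·Z_{rn}` given by the multiplier
`μ_s`: a partition of `1 + r·Z_{rn}` into `m` pairwise disjoint subsets, indexed
cyclically by `ZMod m`, each invariant under `μ_q : x ↦ qx`, and with
`μ_s : x ↦ sx` carrying `X j` onto `X (j+1)` (subscripts modulo `m`). -/
def IsTypeISplitting (q n r : ℕ) (s : ℤ) (m : ℕ)
    (X : ZMod m → Set (ZMod (r * n))) : Prop :=
  Pairwise (Function.onFun Disjoint X) ∧
  (⋃ j, X j) = oneAddRZ n r ∧
  (∀ j, (fun x => (q : ZMod (r * n)) * x) '' X j = X j) ∧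
  (∀ j, (fun x => (s : ZMod (r * n)) * x) '' X j = X (j + 1))

theorem Int.pow_add_dvd_pow_sub_one {l : ℕ} {a : ℕ} {x : ℤ} (ha : a ≠ 0)
    (hx : (l : ℤ) ^ a ∣ x - 1) (b m : ℕ) : (l : ℤ) ^ (a + b) ∣ x ^ (l ^ b * m) - 1 := by
  have key : (l : ℤ) ^ (a + b) ∣ x ^ l ^ b - 1 := by
    induction b with
    | zero => simpa using hx
    | succ b ih =>
      have hgeom := mul_geom_sum (x ^ l ^ b) l
      rw [pow_succ l b, pow_mul, ← hgeom, ← add_assoc, pow_succ]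
      refine mul_dvd_mul ih ?_
      have h1 : x ^ l ^ b ≡ 1 [ZMOD l] :=
        (Int.modEq_iff_dvd.2 ((dvd_pow_self _ (by omega)).trans ih)).symm
      have h2 : ∑ i ∈ Finset.range l, (x ^ l ^ b) ^ i ≡ ∑ i ∈ Finset.range l, 1 [ZMOD l] :=
        Int.ModEq.sum fun i _ => by simpa using h1.pow i
      simpa using (Int.modEq_iff_dvd.1 (h2.trans (by simp [Int.modEq_iff_dvd] : _ ≡ 0 [ZMOD l])).symm)
  rw [pow_mul]
  exact key.trans (by simpa using sub_dvd_pow_sub_pow (x ^ l ^ b) 1 m)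

theorem Int.exists_pow_sub_dvd_of_odd_prime {p : ℕ} (hp : p.Prime) (hodd : Odd p) {a : ℕ}
    (ha : a ≠ 0) {x y : ℤ} (hx : (p : ℤ) ^ a ∣ x - 1) (hx' : ¬ (p : ℤ) ^ (a + 1) ∣ x - 1)
    (hy : (p : ℤ) ^ a ∣ y - 1) (e : ℕ) : ∃ j : ℕ, (p : ℤ) ^ e ∣ x ^ j - y := by
  have hpZ : Prime (p : ℤ) := Nat.prime_iff_prime_int.1 hp
  have hpx : (p : ℤ) ∣ x - 1 := (dvd_pow_self _ ha).trans hx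
  induction e with
  | zero => exact ⟨0, by simp⟩
  | succ e ih =>
    rcases Nat.lt_or_ge e a with hea | hea
    · refine ⟨0, (pow_dvd_pow _ hea).trans ?_⟩
      simpa using (dvd_sub_comm.1 hy)
    obtain ⟨b, rfl⟩ := Nat.exists_eq_add_of_le hea
    obtain ⟨j, c, hc⟩ := ih
    obtain ⟨u, hu⟩ := Int.pow_add_dvd_pow_sub_one ha hx b 1
    rw [mul_one] at hu
    have hpu : ¬ (p : ℤ) ∣ u := by
      rintro hdvd
      have hpx1 : ¬ (p : ℤ) ∣ x := fun h => hpZ.not_dvd_one (by simpa using dvd_sub h hpx)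
      have hlte := Int.emultiplicity_pow_sub_pow hp hodd (x := x) (y := 1) hpx hpx1 (p ^ b)
      have hxa : emultiplicity (p : ℤ) (x - 1) = a := emultiplicity_eq_coe.2 ⟨hx, hx'⟩
      have hpb : emultiplicity p (p ^ b) = b := emultiplicity_pow_self_of_prime hp.prime b
      rw [hxa, hpb, one_pow] at hlte
      have := (emultiplicity_eq_coe (n := a + b)).1 (by simpa using hlte)
      exact this.2 (by rw [hu, pow_succ]; exact mul_dvd_mul_left _ hdvd)
    have hcop : IsCoprime u (p : ℤ) := ((hpZ.coprime_iff_not_dvd).2 hpu).symm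
    obtain ⟨α, β, hαβ⟩ := hcop
    obtain ⟨i, hi⟩ : ∃ i : ℕ, (p : ℤ) ∣ i - (-c * α) :=
      ⟨((-c * α) % p).toNat, by
        rw [Int.toNat_of_nonneg (Int.emod_nonneg _ (by exact_mod_cast hp.ne_zero))]
        exact dvd_sub_comm.1 (Int.dvd_self_sub_emod)⟩
    refine ⟨j + p ^ b * i, ?_⟩
    obtain ⟨w, hw⟩ : (p : ℤ) ∣ x ^ j - 1 := hpx.trans (by simpa using sub_dvd_pow_sub_pow x 1 j)
    have hP : (p : ℤ) ^ (a + b + 1) ∣ (x ^ p ^ b) ^ i - (1 + i * ((p : ℤ) ^ (a + b) * u)) := by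
      have hsq : ((p : ℤ) ^ (a + b) * u) ^ 2 ∣
          (1 + (p : ℤ) ^ (a + b) * u) ^ i - (1 + i * ((p : ℤ) ^ (a + b) * u)) := by
        clear hi
        generalize (p : ℤ) ^ (a + b) * u = z
        induction i with
        | zero => simp
        | succ i ih =>
          obtain ⟨w, hw⟩ := ih
          refine ⟨w * (1 + z) + i, ?_⟩
          rw [pow_succ]
          push_cast
          linear_combination (1 + z) * hw
      rw [show x ^ p ^ b = 1 + (p : ℤ) ^ (a + b) * u by linarith]
      refine Dvd.dvd.trans ?_ hsq
      rw [mul_pow, ← pow_mul]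
      exact Dvd.dvd.mul_right (pow_dvd_pow _ (by omega)) _
    obtain ⟨z, hz⟩ := hP
    obtain ⟨d, hd⟩ := hi
    rw [pow_add x, pow_mul]
    refine ⟨x ^ j * z + w * i * u + d * u + c * β, ?_⟩
    have e1 : (x ^ p ^ b) ^ i =
        1 + i * ((p : ℤ) ^ (a + b) * u) + (p : ℤ) ^ (a + b) * p * z := by
      rw [pow_succ] at hz; linarith
    have e2 : x ^ j = 1 + p * w := by linarith
    have e3 : y = x ^ j - (p : ℤ) ^ (a + b) * c := by linarith
    have e4 : (i : ℤ) = -c * α + p * d := by linarith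
    rw [e3, e1, pow_succ, e2]
    linear_combination ((p : ℤ) ^ (a + b) * u) * e4 - ((p : ℤ) ^ (a + b) * c) * hαβ

theorem IsTypeISplitting.dvd_of_pow_mul_eq {q n r m : ℕ} {s : ℤ} {X : ZMod m → Set (ZMod (r * n))}
    (hX : IsTypeISplitting q n r s m X) {x : ZMod (r * n)} (hx : x ∈ oneAddRZ n r) {k j : ℕ}
    (h : (s : ZMod (r * n)) ^ k * x = (q : ZMod (r * n)) ^ j * x) : m ∣ k := by
  obtain ⟨hdisj, hunion, hqX, hsX⟩ := hX
  rw [← hunion] at hx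
  obtain ⟨i, hi⟩ := Set.mem_iUnion.1 hx
  have h1 : ∀ k : ℕ, (s : ZMod (r * n)) ^ k * x ∈ X (i + k) := by
    intro k
    induction k with
    | zero => simpa using hi
    | succ k ih =>
      rw [Nat.cast_succ, ← add_assoc, ← hsX]
      exact ⟨_, ih, by ring⟩
  have h2 : ∀ k : ℕ, (q : ZMod (r * n)) ^ k * x ∈ X i := by
    intro k
    induction k with
    | zero => simpa using hi
    | succ k ih =>
      rw [← hqX]
      exact ⟨_, ih, by ring⟩
  by_contra hk
  have hne : i + (k : ZMod m) ≠ i := by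
    simpa [ZMod.natCast_eq_zero_iff] using hk
  exact Set.disjoint_left.1 (hdisj hne) (h1 k) (h ▸ h2 j)

theorem exists_mem_oneAddRZ_mul_eq_zero {n r : ℕ} (hn : n ≠ 0) (hr : r ≠ 0) {M : ℤ}
    (hM : ∀ l : ℕ, l.Prime → l ∣ r → (l : ℤ) ^ (r * n).factorization l ∣ M) :
    ∃ x ∈ oneAddRZ n r, (M : ZMod (r * n)) * x = 0 := by
  have hN : r * n ≠ 0 := mul_ne_zero hr hn
  obtain ⟨c, hc⟩ := Nat.gcd_dvd_left (r * n) M.natAbs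
  have hcop : Nat.Coprime r c := by
    refine Nat.Coprime.symm (Nat.coprime_of_dvd fun l hl hlc hlr => ?_)
    have h1 : l ^ (r * n).factorization l ∣ Nat.gcd (r * n) M.natAbs :=
      Nat.dvd_gcd (Nat.ordProj_dvd _ _) (by
        have := Int.natAbs_dvd_natAbs.2 (hM l hl hlr)
        simpa [Int.natAbs_pow] using this)
    refine Nat.pow_succ_factorization_not_dvd hN hl ?_
    rw [pow_succ]
    conv_rhs => rw [hc]
    exact mul_dvd_mul h1 hlc
  obtain ⟨α, β, hαβ⟩ := Nat.isCoprime_iff_coprime.2 hcop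
  refine ⟨((β * c : ℤ) : ZMod (r * n)), ⟨((-α : ℤ) : ZMod (r * n)), ?_⟩, ?_⟩
  · rw [show β * (c : ℤ) = 1 + r * (-α) by linarith]
    push_cast
    ring
  · rw [← Int.cast_mul, ZMod.intCast_zmod_eq_zero_iff_dvd]
    obtain ⟨M', hM'⟩ : ((Nat.gcd (r * n) M.natAbs : ℕ) : ℤ) ∣ M :=
      Int.natCast_dvd.2 (Nat.gcd_dvd_right _ _)
    refine ⟨M' * β, ?_⟩
    conv_lhs => rw [hM']
    conv_rhs => rw [hc]
    push_cast
    ring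

theorem IsTypeISplitting.dvd_of_forall_prime_pow_dvd {q n r m : ℕ} {s : ℤ}
    {X : ZMod m → Set (ZMod (r * n))} (hX : IsTypeISplitting q n r s m X)
    (hn : n ≠ 0) (hr : r ≠ 0) {k j : ℕ}
    (h : ∀ l : ℕ, l.Prime → l ∣ r → (l : ℤ) ^ (r * n).factorization l ∣ s ^ k - (q : ℤ) ^ j) :
    m ∣ k := by
  obtain ⟨x, hx, hx0⟩ := exists_mem_oneAddRZ_mul_eq_zero hn hr h
  refine hX.dvd_of_pow_mul_eq hx (j := j) ?_
  push_cast at hx0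
  rw [← sub_eq_zero, ← sub_mul, hx0]

theorem pow_factorization_mul_dvd_pow_sub_one {n r l p : ℕ} {x : ℤ} (hn : n ≠ 0) (hr : r ≠ 0)
    (hx : (r : ℤ) ∣ x - 1) (hl : l.Prime) (hlr : l ∣ r) (hlp : l ≠ p) :
    (l : ℤ) ^ (r * n).factorization l ∣ x ^ (n / p ^ n.factorization p) - 1 := by
  have hfac : (n / p ^ n.factorization p).factorization l = n.factorization l := by
    rw [Nat.factorization_ordCompl, Finsupp.erase_ne hlp]
  obtain ⟨m, hm⟩ := Nat.ordProj_dvd (n / p ^ n.factorization p) l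
  rw [Nat.factorization_mul hr hn, Finsupp.add_apply, hm, hfac]
  refine Int.pow_add_dvd_pow_sub_one (hl.factorization_pos_of_dvd hr hlr).ne' ?_ _ _
  exact Dvd.dvd.trans (by exact_mod_cast Nat.ordProj_dvd r l) hx

theorem IsTypeISplitting.prime_dvd_and_not_pow_dvd {q n r p : ℕ} {s : ℤ}
    {X : ZMod p → Set (ZMod (r * n))} (hX : IsTypeISplitting q n r s p X)
    (hp : p.Prime) (hn : n ≠ 0) (hr : r ≠ 0) (hsr : (r : ℤ) ∣ s - 1) (hqr : (r : ℤ) ∣ (q : ℤ) - 1) :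
    p ∣ r ∧ ∀ j : ℕ, ¬ (p : ℤ) ^ (r * n).factorization p ∣ s - (q : ℤ) ^ j := by
  have hk : ¬ p ∣ n / p ^ n.factorization p := Nat.not_dvd_ordCompl hp hn
  constructor
  · by_contra hpr
    refine hk (hX.dvd_of_forall_prime_pow_dvd hn hr (j := 0) fun l hl hlr => ?_)
    rw [pow_zero]
    exact pow_factorization_mul_dvd_pow_sub_one hn hr hsr hl hlr (by rintro rfl; exact hpr hlr)
  · intro j hj
    refine hk (hX.dvd_of_forall_prime_pow_dvd hn hr
      (j := (n / p ^ n.factorization p) * j) fun l hl hlr => ?_)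
    rcases eq_or_ne l p with rfl | hlp
    · rw [pow_mul']
      exact hj.trans (sub_dvd_pow_sub_pow _ _ _)
    · have h1 := pow_factorization_mul_dvd_pow_sub_one hn hr hsr hl hlr hlp
      have h2 := pow_factorization_mul_dvd_pow_sub_one hn hr hqr hl hlr hlp
      have h3 : ((q : ℤ) ^ (n / p ^ n.factorization p)) - 1 ∣
          (q : ℤ) ^ ((n / p ^ n.factorization p) * j) - 1 := by
        rw [pow_mul]
        exact by simpa using sub_dvd_pow_sub_pow ((q : ℤ) ^ (n / p ^ n.factorization p)) 1 j
      simpa using dvd_sub h1 (h2.trans h3)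

theorem image_mul_left_oneAddRZ_fiber {n r : ℕ} {R : Type*} [AddGroup R] (f : ZMod (r * n) → R)
    {u : ZMod (r * n)} (hu : IsUnit u) (hur : u ∈ oneAddRZ n r) {c : R}
    (hf : ∀ x ∈ oneAddRZ n r, f (u * x) = f x + c) (j : R) :
    (fun x => u * x) '' {x ∈ oneAddRZ n r | f x = j} = {x ∈ oneAddRZ n r | f x = j + c} := by
  obtain ⟨m, hm⟩ := hur
  ext y
  constructor
  · rintro ⟨x, ⟨hx, rfl⟩, rfl⟩
    refine ⟨?_, hf x hx⟩
    obtain ⟨k, rfl⟩ := hx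
    exact ⟨m + k + r * m * k, by rw [hm]; ring⟩
  · rintro ⟨⟨k, hk⟩, hy⟩
    obtain ⟨z, rfl⟩ := hu.dvd (a := y)
    have hz : z ∈ oneAddRZ n r := ⟨k - m * z, by rw [hm] at hk; linear_combination hk⟩
    rw [hf z hz] at hy
    exact ⟨z, ⟨hz, add_right_cancel hy⟩, rfl⟩

theorem val_mul_ediv_pow {n r p v : ℕ} (hp : p ≠ 0) (hpr : p ∣ r)
    (hv : p ^ (v + 1) ∣ r * n) {u t : ℤ} (hu : u = 1 + (p : ℤ) ^ v * t) {x : ZMod (r * n)}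
    [NeZero (r * n)]
    (hx : x ∈ oneAddRZ n r) :
    ((((u : ZMod (r * n)) * x).val / (p ^ v : ℕ) : ℕ) : ZMod p) =
      ((x.val / p ^ v : ℕ) : ZMod p) + t := by
  have hx1 : ((x.val : ℕ) : ZMod p) = 1 := by
    obtain ⟨k, rfl⟩ := hx
    have h : (((1 + (r : ZMod (r * n)) * k).val : ℕ) : ZMod (r * n)) =
        ((1 + r * k.val : ℕ) : ZMod (r * n)) := by simp
    have h' := ((ZMod.natCast_eq_natCast_iff _ _ _).1 h).of_dvd (hpr.mul_right n)
    rw [(ZMod.natCast_eq_natCast_iff _ _ _).2 h']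
    simp [(ZMod.natCast_eq_zero_iff r p).2 hpr]
  obtain ⟨c, hc⟩ : ((r * n : ℕ) : ℤ) ∣ ((u : ZMod (r * n)) * x).val - u * x.val := by
    rw [← ZMod.intCast_zmod_eq_zero_iff_dvd]
    simp
  obtain ⟨d, hd⟩ := hv
  have h3 : ((((u : ZMod (r * n)) * x).val : ℕ) : ℤ) =
      x.val + (p : ℤ) ^ v * (t * x.val + p * d * c) := by
    rw [show ((r * n : ℕ) : ℤ) = (p : ℤ) ^ (v + 1) * d by exact_mod_cast hd] at hc
    rw [hu] at hc ⊢
    rw [pow_succ] at hc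
    linear_combination hc
  have hpv : (p : ℤ) ^ v ≠ 0 := pow_ne_zero _ (by exact_mod_cast hp)
  rw [← Int.cast_natCast, Int.natCast_div, h3]
  push_cast
  rw [Int.add_mul_ediv_left _ _ hpv]
  push_cast
  rw [← Int.cast_natCast (x.val / p ^ v), Int.natCast_div, hx1]
  simp

theorem exists_isTypeISplitting {q n r p v : ℕ} {s t : ℤ} (hp : p.Prime) [NeZero (r * n)]
    (hpr : p ∣ r) (hq : Nat.Coprime q (r * n)) (hs : IsCoprime s (r * n : ℕ))
    (hqr : (r : ℤ) ∣ (q : ℤ) - 1) (hsr : (r : ℤ) ∣ s - 1)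
    (hv : p ^ (v + 1) ∣ r * n) (hqv : (p : ℤ) ^ (v + 1) ∣ (q : ℤ) - 1)
    (hst : s = 1 + (p : ℤ) ^ v * t) (ht : ¬ (p : ℤ) ∣ t) :
    ∃ X : ZMod p → Set (ZMod (r * n)), IsTypeISplitting q n r s p X := by
  have := Fact.mk hp
  have ht0 : (t : ZMod p) ≠ 0 := fun h => ht ((ZMod.intCast_zmod_eq_zero_iff_dvd _ _).1 h)
  have hmem : ∀ u : ℤ, (r : ℤ) ∣ u - 1 → (u : ZMod (r * n)) ∈ oneAddRZ n r := by
    rintro u ⟨k, hk⟩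
    refine ⟨k, ?_⟩
    rw [show u = 1 + r * k by linarith]
    push_cast
    ring
  let f : ZMod (r * n) → ZMod p := fun x => ((x.val / p ^ v : ℕ) : ZMod p) * (t : ZMod p)⁻¹
  refine ⟨fun j => {x ∈ oneAddRZ n r | f x = j}, ?_, ?_, fun j => ?_, fun j => ?_⟩
  · intro i j hij
    exact Set.disjoint_left.2 fun x hx hx' => hij (hx.2.symm.trans hx'.2)
  · ext x
    simp
  · have h := image_mul_left_oneAddRZ_fiber f (u := (q : ZMod (r * n))) (c := 0)
      ((ZMod.isUnit_iff_coprime _ _).2 hq) (by simpa using hmem q hqr) (fun x hx => ?_) j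
    · simpa using h
    obtain ⟨d, hd⟩ := hqv
    have := val_mul_ediv_pow hp.ne_zero hpr hv (u := q) (t := p * d)
      (by rw [pow_succ] at hd; linarith) hx
    simp only [f]
    push_cast at this ⊢
    rw [this]
    simp
  · refine image_mul_left_oneAddRZ_fiber f (u := (s : ZMod (r * n))) (c := 1)
      ?_ (hmem s hsr) (fun x hx => ?_) j
    · exact ZMod.coe_int_isUnit_iff_isCoprime s (r * n) |>.2 hs.symm
    have := val_mul_ediv_pow hp.ne_zero hpr hv hst hx
    simp only [f]
    rw [this, add_mul, mul_inv_cancel₀ ht0]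

/-- Corollary for odd primes `p`.  Let `p` be an odd prime
and let `s` be an integer with `gcd(s, rn) = 1`, `s ≡ 1 (mod r)` and `s ≠ 1`.
A Type I `p`-adic splitting of `1 + r·Z_{rn}` given by `μ_s` exists iff
`p ∣ gcd(n, r)` and `ν_p(s-1) < min (ν_p(q-1)) (ν_p(rn))`. -/
theorem typeI_padic_multiplier_iff_odd (q n r : ℕ) (hq : IsPrimePow q)
    (hn : 0 < n) (hqn : Nat.gcd q n = 1) (hr : 0 < r) (hrdvd : r ∣ q - 1)
    (p : ℕ) (hp : p.Prime) (hpodd : Odd p)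
    (s : ℤ) (hs : Int.gcd s (r * n) = 1) (hsr : (r : ℤ) ∣ s - 1) (hs1 : s ≠ 1) :
    (∃ X : ZMod p → Set (ZMod (r * n)), IsTypeISplitting q n r s p X) ↔
      (p ∣ Nat.gcd n r ∧
        padicValInt p (s - 1) <
          min ((q - 1).factorization p) ((r * n).factorization p)) := by
  have hN : r * n ≠ 0 := mul_ne_zero hr.ne' hn.ne'
  have hq2 : 2 ≤ q := hq.two_le
  have hqsub : ((q - 1 : ℕ) : ℤ) = (q : ℤ) - 1 := by push_cast [show 1 ≤ q by omega]; rfl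
  have hq1 : q - 1 ≠ 0 := by omega
  have hqr : (r : ℤ) ∣ (q : ℤ) - 1 := hqsub ▸ Int.natCast_dvd_natCast.2 hrdvd
  have := Fact.mk hp
  have hsub : s - 1 ≠ 0 := sub_ne_zero.2 hs1
  have hsdvd : ∀ e : ℕ, (p : ℤ) ^ e ∣ s - 1 ↔ e ≤ padicValInt p (s - 1) := fun e => by
    simpa [hsub] using padicValInt_dvd_iff (p := p) e (s - 1)
  have hqdvd : ∀ e : ℕ, (p : ℤ) ^ e ∣ (q : ℤ) - 1 ↔ e ≤ (q - 1).factorization p := fun e => by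
    rw [← hqsub, ← hp.pow_dvd_iff_le_factorization hq1]
    exact_mod_cast Iff.rfl
  constructor
  · rintro ⟨X, hX⟩
    obtain ⟨hpr, hnot⟩ := hX.prime_dvd_and_not_pow_dvd hp hn.ne' hr.ne' hsr hqr
    have h1 : padicValInt p (s - 1) < (r * n).factorization p := by
      by_contra! hle
      exact hnot 0 (by simpa using (hsdvd _).2 hle)
    have h2 : padicValInt p (s - 1) < (q - 1).factorization p := by
      by_contra! hle
      obtain ⟨j, hj⟩ := Int.exists_pow_sub_dvd_of_odd_prime hp hpodd
        (hp.factorization_pos_of_dvd hq1 (hpr.trans hrdvd)).ne' ((hqdvd _).2 le_rfl)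
        (fun h => absurd ((hqdvd _).1 h) (by omega)) ((hsdvd _).2 hle) ((r * n).factorization p)
      exact hnot j (dvd_sub_comm.1 hj)
    refine ⟨Nat.dvd_gcd ?_ hpr, lt_min h2 h1⟩
    by_contra hpn
    have hle : r.factorization p ≤ padicValInt p (s - 1) :=
      (hsdvd _).1 (Dvd.dvd.trans (by exact_mod_cast Nat.ordProj_dvd r p) hsr)
    rw [Nat.factorization_mul hr.ne' hn.ne', Finsupp.add_apply,
      Nat.factorization_eq_zero_of_not_dvd hpn] at h1
    omega
  · rintro ⟨hpg, hlt⟩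
    obtain ⟨h1, h2⟩ := lt_min_iff.1 hlt
    have : NeZero (r * n) := ⟨hN⟩
    obtain ⟨t, ht⟩ := (hsdvd _).2 le_rfl
    have hqcop : Nat.Coprime q r := by
      refine Nat.Coprime.coprime_dvd_right hrdvd ?_
      exact ((Nat.coprime_self_sub_right (by omega : 1 ≤ q)).2 (Nat.coprime_one_right q))
    refine exists_isTypeISplitting hp (hpg.trans (Nat.gcd_dvd_right _ _))
      (hqcop.mul_right hqn) (by push_cast; exact Int.isCoprime_iff_gcd_eq_one.2 hs) hqr hsr
      ((hp.pow_dvd_iff_le_factorization hN).2 h2) ((hqdvd _).2 h1)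
      (t := t) (by linarith) fun ⟨w, hw⟩ => ?_
    have := (hsdvd (padicValInt p (s - 1) + 1)).1 ⟨w, ht.trans (by rw [hw, pow_succ, mul_assoc])⟩
    omega
end

section
/- There exists a partition 1+rZ_{rn} = X_0 ∪ X_1 into two disjoint subsets with μ_q(X_0) = X_0, μ_q(X_1) = X_1, μ_{−1}(X_0) = X_1 and μ_{−1}(X_1) = X_0 (i.e., a Type I duadic splitting of 1+rZ_{rn} given by μ_{−1}) if and only if n is even, r = 2, and one of the following two conditions holds: (i) q ≡ 1 (mod 4); (ii) q ≡ 3 (mod 4) and ν₂(q+1) < ν₂(rn). -/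
theorem lt_half_mod_iff {K c q x : ℕ} (hK : 2 ∣ K) (hc : c % 2 = 1) (hqc : q + 1 = K * c)
    (hx : x % 2 = 1) : (q * x) % (2 * K) < K ↔ x % (2 * K) < K := by
  obtain ⟨L, rfl⟩ := hK
  have hL : 0 < L := by
    rcases Nat.eq_zero_or_pos L with rfl | h
    · simp at hqc
    · exact h
  have h1 : (q * x + x) % (2 * (2 * L)) = 2 * L := by
    have hcx : (c * x) % 2 = 1 := by simp [Nat.mul_mod, hc, hx]
    obtain ⟨t, ht⟩ : ∃ t, c * x = 2 * t + 1 := ⟨c * x / 2, by omega⟩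
    have h2 : q * x + x = 2 * L + 2 * (2 * L) * t := by
      calc q * x + x = (q + 1) * x := by ring
        _ = 2 * L * (c * x) := by rw [hqc]; ring
        _ = _ := by rw [ht]; ring
    rw [h2, Nat.add_mul_mod_self_left, Nat.mod_eq_of_lt (by omega)]
  have hs : x % (2 * (2 * L)) % 2 = 1 := by
    rw [Nat.mod_mul_right_mod, hx]
  have hw := Nat.mod_lt (q * x) (show 2 * (2 * L) > 0 by omega)
  have hs' := Nat.mod_lt x (show 2 * (2 * L) > 0 by omega)
  rw [Nat.add_mod] at h1
  generalize q * x % (2 * (2 * L)) = w at *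
  generalize x % (2 * (2 * L)) = s at *
  rcases lt_or_ge (w + s) (2 * (2 * L)) with h | h
  · rw [Nat.mod_eq_of_lt h] at h1
    omega
  · rw [Nat.mod_eq_sub_mod h, Nat.mod_eq_of_lt (by omega)] at h1
    omega

theorem mem_oneAddRZ_two_iff {n : ℕ} [NeZero (2 * n)] (x : ZMod (2 * n)) :
    x ∈ oneAddRZ n 2 ↔ x.val % 2 = 1 := by
  constructor
  · rintro ⟨k, rfl⟩
    have h : (1 + ((2 : ℕ) : ZMod (2 * n)) * k) = ((1 + 2 * k.val : ℕ) : ZMod (2 * n)) := by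
      push_cast
      rw [ZMod.natCast_zmod_val]
    rw [h, ZMod.val_natCast, Nat.mod_mul_right_mod]
    omega
  · intro h
    refine ⟨((x.val / 2 : ℕ) : ZMod (2 * n)), ?_⟩
    conv_lhs => rw [← ZMod.natCast_zmod_val x, show x.val = 1 + 2 * (x.val / 2) by omega]
    push_cast
    rfl

/-- The residues `x` that are odd and whose remainder modulo `2 * K` lies in the lower half
exactly when `b` holds. -/
def oddHalf (N K : ℕ) (b : Prop) : Set (ZMod N) :=
  {x | x.val % 2 = 1 ∧ (x.val % (2 * K) < K ↔ b)}

theorem image_mul_oddHalf {N K c q : ℕ} [NeZero N] (hK : 2 ∣ K) (hKN : 2 * K ∣ N)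
    (hc : c % 2 = 1) (hqc : q + 1 = K * c) (hq : q.Coprime N) (b : Prop) :
    (fun x => (q : ZMod N) * x) '' oddHalf N K b = oddHalf N K b := by
  have hinj : Function.Injective (fun x => (q : ZMod N) * x) :=
    ((ZMod.isUnit_iff_coprime q N).2 hq).mul_right_injective
  refine Set.eq_of_subset_of_ncard_le ?_ (Set.ncard_image_of_injective _ hinj).ge (Set.toFinite _)
  rintro _ ⟨x, ⟨hx, hb⟩, rfl⟩
  have h2N : 2 ∣ N := (Dvd.intro _ rfl).trans hKN
  have hq2 : q % 2 = 1 := by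
    have : 2 ∣ q + 1 := hqc ▸ hK.mul_right c
    omega
  have hval : ((q : ZMod N) * x).val = (q * x.val) % N := by
    conv_lhs => rw [← ZMod.natCast_zmod_val x, ← Nat.cast_mul, ZMod.val_natCast]
  refine ⟨?_, ?_⟩
  · simp only [hval, Nat.mod_mod_of_dvd _ h2N]
    simp [Nat.mul_mod, hq2, hx]
  · simp only [hval, Nat.mod_mod_of_dvd _ hKN]
    exact (lt_half_mod_iff hK hc hqc hx).trans hb

theorem neg_mem_oddHalf {N K : ℕ} [NeZero N] (hK : 2 ∣ K) (hKN : 2 * K ∣ N) {b : Prop}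
    {x : ZMod N} (hx : x ∈ oddHalf N K b) : -x ∈ oddHalf N K (¬ b) := by
  obtain ⟨hx, hb⟩ := hx
  have h2N : 2 ∣ N := (Dvd.intro _ rfl).trans hKN
  have hlt := ZMod.val_lt x
  have hval : (-x).val = N - x.val := by
    rw [ZMod.neg_val', Nat.mod_eq_of_lt (by omega)]
  refine ⟨by omega, ?_⟩
  rw [← hb, hval]
  have hadd : (N - x.val + x.val) % (2 * K) = 0 := by
    rw [Nat.sub_add_cancel hlt.le]
    exact Nat.mod_eq_zero_of_dvd hKN
  have hs : x.val % (2 * K) % 2 = 1 := by rw [Nat.mod_mul_right_mod, hx]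
  have hK0 : 0 < 2 * K := Nat.pos_of_dvd_of_pos hKN (NeZero.pos N)
  have hw := Nat.mod_lt (N - x.val) hK0
  have hs' := Nat.mod_lt x.val hK0
  rw [Nat.add_mod] at hadd
  generalize (N - x.val) % (2 * K) = w at *
  generalize x.val % (2 * K) = s at *
  rcases lt_or_ge (w + s) (2 * K) with h | h
  · rw [Nat.mod_eq_of_lt h] at hadd
    omega
  · rw [Nat.mod_eq_sub_mod h, Nat.mod_eq_of_lt (by omega)] at hadd
    omega

theorem image_neg_oddHalf {N K : ℕ} [NeZero N] (hK : 2 ∣ K) (hKN : 2 * K ∣ N) (b : Prop) :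
    (fun x => -x) '' oddHalf N K b = oddHalf N K (¬ b) := by
  refine Set.Subset.antisymm ?_ fun x hx => ⟨-x, ?_, neg_neg x⟩
  · rintro _ ⟨x, hx, rfl⟩
    exact neg_mem_oddHalf hK hKN hx
  · simpa using neg_mem_oddHalf hK hKN hx

theorem exists_splitting_of_factorization_lt {q n : ℕ} (hn : 0 < n) (hq : q % 2 = 1)
    (hqn : q.Coprime n) (hlt : (q + 1).factorization 2 < (2 * n).factorization 2) :
    ∃ X0 X1 : Set (ZMod (2 * n)),
      Disjoint X0 X1 ∧ X0 ∪ X1 = oneAddRZ n 2 ∧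
      (fun x => (q : ZMod (2 * n)) * x) '' X0 = X0 ∧
      (fun x => (q : ZMod (2 * n)) * x) '' X1 = X1 ∧
      (fun x => -x) '' X0 = X1 ∧ (fun x => -x) '' X1 = X0 := by
  have : NeZero (2 * n) := ⟨by omega⟩
  set v := (q + 1).factorization 2 with hv
  have hv1 : 1 ≤ v :=
    (Nat.prime_two.dvd_iff_one_le_factorization (by omega)).1 (by omega)
  have hK : 2 ∣ 2 ^ v := dvd_pow_self 2 (by omega)
  have hKN : 2 * 2 ^ v ∣ 2 * n := by
    rw [← pow_succ', Nat.prime_two.pow_dvd_iff_le_factorization (by omega)]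
    exact hlt
  have hqc : q + 1 = 2 ^ v * ((q + 1) / 2 ^ v) := (Nat.ordProj_mul_ordCompl_eq_self (q + 1) 2).symm
  have hc : (q + 1) / 2 ^ v % 2 = 1 := by
    have := Nat.not_dvd_ordCompl Nat.prime_two (show q + 1 ≠ 0 by omega)
    rw [← hv] at this
    omega
  have hqN : q.Coprime (2 * n) :=
    Nat.Coprime.mul_right (Nat.coprime_two_right.2 (Nat.odd_iff.2 hq)) hqn
  refine ⟨oddHalf _ (2 ^ v) True, oddHalf _ (2 ^ v) (¬ True), ?_, ?_,
    image_mul_oddHalf hK hKN hc hqc hqN _, image_mul_oddHalf hK hKN hc hqc hqN _,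
    image_neg_oddHalf hK hKN _, ?_⟩
  · rw [Set.disjoint_left]
    rintro x ⟨_, h⟩ ⟨_, h'⟩
    tauto
  · ext x
    rw [mem_oneAddRZ_two_iff]
    simp only [oddHalf, Set.mem_union, Set.mem_ofPred_eq]
    tauto
  · simpa using image_neg_oddHalf hK hKN (¬ True)

theorem neg_ne_mul_of_splitting {R : Type*} [Ring R] {X0 X1 S : Set R} {q x : R}
    (hd : Disjoint X0 X1) (hu : X0 ∪ X1 = S)
    (h0 : (fun x => q * x) '' X0 = X0) (h1 : (fun x => q * x) '' X1 = X1)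
    (hn0 : (fun x => -x) '' X0 = X1) (hn1 : (fun x => -x) '' X1 = X0) (hx : x ∈ S) :
    -x ≠ x ∧ q * x ≠ -x := by
  rw [Set.disjoint_left] at hd
  have key : ∀ A B : Set R, (∀ y ∈ A, y ∉ B) → (fun x => q * x) '' A = A →
      (fun x => -x) '' A = B → x ∈ A → -x ≠ x ∧ q * x ≠ -x := by
    intro A B hAB hA hB hxA
    have hneg : -x ∈ B := hB ▸ ⟨x, hxA, rfl⟩
    have hmul : q * x ∈ A := by
      have : q * x ∈ (fun x => q * x) '' A := ⟨x, hxA, rfl⟩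
      rwa [hA] at this
    exact ⟨fun h => hAB x hxA (h ▸ hneg), fun h => hAB _ hmul (h ▸ hneg)⟩
  rw [← hu] at hx
  rcases hx with hx | hx
  · exact key X0 X1 (fun y h => hd h) h0 hn0 hx
  · exact key X1 X0 (fun y h h' => hd h' h) h1 hn1 hx

theorem dvd_two_of_neg_one_mem {n r : ℕ} (h : (-1 : ZMod (r * n)) ∈ oneAddRZ n r) : r ∣ 2 := by
  obtain ⟨k, hk⟩ := h
  have h1 := congrArg (ZMod.castHom (Dvd.intro n rfl : r ∣ r * n) (ZMod r)) hk
  simp only [map_neg, map_add, map_mul, map_one, map_natCast, CharP.cast_eq_zero, zero_mul,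
    add_zero] at h1
  rw [← CharP.cast_eq_zero_iff (ZMod r) r 2]
  push_cast
  linear_combination -h1

/-- Corollary on `μ_{-1}`.  A Type I duadic splitting of
`1 + r·Z_{rn}` given by `μ_{-1}` exists (a partition into `X0`, `X1` with `μ_q`
fixing each part and `x ↦ -x` interchanging them) iff `n` is even, `r = 2`, and
either `q ≡ 1 (mod 4)`, or `q ≡ 3 (mod 4)` and `ν₂(q+1) < ν₂(rn)`. -/
theorem typeI_duadic_neg_one_iff (q n r : ℕ) (hq : IsPrimePow q)
    (hn : 0 < n) (hqn : Nat.gcd q n = 1) (hr : 0 < r) (hrdvd : r ∣ q - 1) :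
    (∃ X0 X1 : Set (ZMod (r * n)),
        Disjoint X0 X1 ∧ X0 ∪ X1 = oneAddRZ n r ∧
        (fun x => (q : ZMod (r * n)) * x) '' X0 = X0 ∧
        (fun x => (q : ZMod (r * n)) * x) '' X1 = X1 ∧
        (fun x => -x) '' X0 = X1 ∧ (fun x => -x) '' X1 = X0) ↔
      (2 ∣ n ∧ r = 2 ∧
        (q % 4 = 1 ∨
          (q % 4 = 3 ∧ (q + 1).factorization 2 < (r * n).factorization 2))) := by
  constructor
  · rintro ⟨X0, X1, hd, hu, h0, h1, hn0, hn1⟩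
    have key {x} (hx : x ∈ oneAddRZ n r) := neg_ne_mul_of_splitting hd hu h0 h1 hn0 hn1 hx
    have hneg : (-1 : ZMod (r * n)) ∈ oneAddRZ n r := by
      have h : (1 : ZMod (r * n)) ∈ X0 ∪ X1 := hu ▸ ⟨0, by simp⟩
      rw [← hu]
      rcases h with h | h
      · exact Or.inr (hn0 ▸ ⟨1, h, rfl⟩)
      · exact Or.inl (hn1 ▸ ⟨1, h, rfl⟩)
    rcases (Nat.dvd_prime Nat.prime_two).1 (dvd_two_of_neg_one_mem hneg) with rfl | rfl
    · exact ((key (x := 0) ⟨-1, by simp⟩).1 neg_zero).elim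
    have : NeZero (2 * n) := ⟨by omega⟩
    have hodd {m : ℕ} (hm : m % 2 = 1) : (m : ZMod (2 * n)) ∈ oneAddRZ n 2 := by
      rw [mem_oneAddRZ_two_iff, ZMod.val_natCast, Nat.mod_mul_right_mod, hm]
    have hn2 : 2 ∣ n := by
      by_contra hn2
      refine (key (hodd (m := n) (by omega))).1 ?_
      rw [neg_eq_iff_add_eq_zero, ← two_mul]
      exact_mod_cast ZMod.natCast_self (2 * n)
    have hq1 := hq.one_lt
    refine ⟨hn2, rfl, ?_⟩
    rcases (show q % 4 = 1 ∨ q % 4 = 3 by omega) with h | h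
    · exact Or.inl h
    refine Or.inr ⟨h, ?_⟩
    by_contra! hle
    have hm : (2 * n) / 2 ^ (2 * n).factorization 2 % 2 = 1 := by
      have := Nat.not_dvd_ordCompl Nat.prime_two (show 2 * n ≠ 0 by omega)
      omega
    refine (key (hodd hm)).2 ?_
    rw [eq_neg_iff_add_eq_zero, ← add_one_mul]
    have hdvd : 2 * n ∣ (q + 1) * ((2 * n) / 2 ^ (2 * n).factorization 2) := by
      conv_lhs => rw [← Nat.ordProj_mul_ordCompl_eq_self (2 * n) 2]
      exact Nat.mul_dvd_mul_right
        ((Nat.prime_two.pow_dvd_iff_le_factorization (by omega)).2 hle) _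
    exact_mod_cast (ZMod.natCast_eq_zero_iff _ _).2 hdvd
  · rintro ⟨hn2, rfl, h⟩
    refine exists_splitting_of_factorization_lt hn (by omega) hqn ?_
    rcases h with h | ⟨_, h⟩
    · have hlt : (q + 1).factorization 2 < 2 := by
        by_contra! hle
        have := (Nat.prime_two.pow_dvd_iff_le_factorization (show q + 1 ≠ 0 by omega)).2 hle
        omega
      exact hlt.trans_le
        ((Nat.prime_two.pow_dvd_iff_le_factorization (by omega)).1 (by omega))
    · exact h
end

section
/- Let p be a prime, let q be a prime power with ν_p(q−1) ≥ 2, and let n, r be positive integers with rn dividing q−1, ν_p(r) ≥ 1 and ν_p(n) ≥ 1. For j = 0, 1, ..., p−1, set X_j = { 1+ir mod rn : i integer, jn/p ≤ i < (j+1)n/p } ⊆ Z_{rn}. Then X_0, X_1, ..., X_{p−1} are pairwise disjoint, their union is 1+rZ_{rn}, each X_j satisfies μ_q(X_j) = X_j, and μ_s(X_j) = X_{j+1} for j = 0,...,p−1 (subscripts modulo p), where s = 1 + rn/p; that is, {X_0,...,X_{p−1}} is a Type I p-adic splitting of 1+rZ_{rn} given by the multiplier μ_{1+rn/p}. -/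
theorem natCast_mul_natCast_eq_iff {n r : ℕ} (hr : 0 < r) (i k : ℕ) :
    (i : ZMod (r * n)) * (r : ZMod (r * n)) = (k : ZMod (r * n)) * (r : ZMod (r * n)) ↔
      i ≡ k [MOD n] := by
  rw [← Nat.cast_mul, ← Nat.cast_mul, ZMod.natCast_eq_natCast_iff, mul_comm i, mul_comm k]
  exact ⟨fun h => Nat.ModEq.mul_left_cancel' hr.ne' h, fun h => h.mul_left' r⟩

theorem natCast_div_eq_of_modEq {p b i k : ℕ} (h : i ≡ k [MOD p * b]) :
    ((i / b : ℕ) : ZMod p) = ((k / b : ℕ) : ZMod p) := by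
  rw [ZMod.natCast_eq_natCast_iff']
  rw [Nat.ModEq, mul_comm p b] at h
  rw [← Nat.mod_mul_right_div_self i b p, ← Nat.mod_mul_right_div_self k b p, h]

/-- The blocks `{1 + i * r | j * n / p ≤ i < (j + 1) * n / p}`, with `n = p * b`, described by the
residue of `i / b` modulo `p`, where `i` ranges over all natural numbers. -/
theorem block_eq {p b r : ℕ} (hp : 0 < p) (hb : 0 < b) (hr : 0 < r) (j : ZMod p) :
    {x : ZMod (r * (p * b)) | ∃ i : ℕ, j.val * (p * b) / p ≤ i ∧ i < (j.val + 1) * (p * b) / p ∧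
        x = 1 + (i : ZMod (r * (p * b))) * (r : ZMod (r * (p * b)))} =
      {x | ∃ i : ℕ, ((i / b : ℕ) : ZMod p) = j ∧
        x = 1 + (i : ZMod (r * (p * b))) * (r : ZMod (r * (p * b)))} := by
  have : NeZero p := ⟨hp.ne'⟩
  have div_eq (m : ℕ) : m * (p * b) / p = m * b := by
    rw [mul_left_comm, Nat.mul_div_cancel_left _ hp]
  ext x
  simp only [Set.mem_ofPred_eq, div_eq]
  constructor
  · rintro ⟨i, h₁, h₂, rfl⟩
    refine ⟨i, ?_, rfl⟩
    rw [Nat.div_eq_of_lt_le h₁ h₂, ZMod.natCast_zmod_val]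
  · rintro ⟨i, rfl, rfl⟩
    have hval : ((i / b : ℕ) : ZMod p).val = i % (p * b) / b := by
      rw [ZMod.val_natCast, mul_comm p b, Nat.mod_mul_right_div_self]
    refine ⟨i % (p * b), ?_, ?_, ?_⟩
    · rw [hval]
      exact Nat.div_mul_le_self _ _
    · rw [hval, mul_comm (_ + 1) b]
      exact Nat.lt_mul_div_succ _ hb
    · rw [add_right_inj, natCast_mul_natCast_eq_iff hr]
      exact (Nat.mod_modEq _ _).symm

/-- Multiplication by `1 + r * b` acts as `i ↦ i + b` on the residues `1 + i * r`. -/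
theorem one_add_mul_one_add_mul {p a b : ℕ} (i : ℕ) :
    ((1 + p * a * b : ℕ) : ZMod (p * a * (p * b))) * (1 + i * (p * a : ℕ)) =
      1 + ((i + b : ℕ) : ZMod (p * a * (p * b))) * (p * a : ℕ) := by
  have h : ((p * a * (p * b) : ℕ) : ZMod (p * a * (p * b))) = 0 := ZMod.natCast_self _
  push_cast at h ⊢
  linear_combination (i * a : ZMod (p * a * (p * b))) * h

/-- Proposition: explicit `p`-adic splitting.  Let `p` be a
prime, `q` a prime power with `ν_p(q-1) ≥ 2`, and `n`, `r` positive with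
`rn ∣ q - 1`, `ν_p(r) ≥ 1`, `ν_p(n) ≥ 1`.  For `j = 0, …, p-1` set
`X_j = {1 + i·r mod rn : j·n/p ≤ i < (j+1)·n/p}`.  Then `{X_0, …, X_{p-1}}` is a
Type I `p`-adic splitting of `1 + r·Z_{rn}` given by the multiplier
`μ_{1 + rn/p}` (pairwise disjoint, union `1 + r·Z_{rn}`, each `μ_q`-invariant,
and `μ_{1+rn/p}(X_j) = X_{j+1}` cyclically). -/
theorem explicit_padic_splitting (p : ℕ) (hp : p.Prime) (q : ℕ)
    (hq : IsPrimePow q) (hqv : 2 ≤ (q - 1).factorization p)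
    (n r : ℕ) (hn : 0 < n) (hr : 0 < r) (hdvd : r * n ∣ q - 1)
    (hrv : 1 ≤ r.factorization p) (hnv : 1 ≤ n.factorization p)
    (X : ZMod p → Set (ZMod (r * n)))
    (hX : ∀ j : ZMod p,
      X j = {x | ∃ i : ℕ, j.val * n / p ≤ i ∧ i < (j.val + 1) * n / p ∧
        x = 1 + (i : ZMod (r * n)) * (r : ZMod (r * n))}) :
    IsTypeISplitting q n r ((1 + r * n / p : ℕ) : ℤ) p X := by
  obtain ⟨a, rfl⟩ : p ∣ r := Nat.dvd_of_factorization_pos (by omega)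
  obtain ⟨b, rfl⟩ : p ∣ n := Nat.dvd_of_factorization_pos (by omega)
  have hb : 0 < b := Nat.pos_of_mul_pos_left hn
  have hs : p * a * (p * b) / p = p * a * b := by
    rw [mul_left_comm, Nat.mul_div_cancel_left _ hp.pos]
  have hq1 : (q : ZMod (p * a * (p * b))) = 1 := by
    have h := (Nat.modEq_iff_dvd' hq.one_lt.le).2 hdvd
    simpa using ((ZMod.natCast_eq_natCast_iff _ _ _).2 h).symm
  have : NeZero (p * a * (p * b)) := ⟨(Nat.mul_pos hr hn).ne'⟩
  simp only [block_eq hp.pos hb hr] at hX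
  refine ⟨fun j k hjk => ?_, ?_, fun j => ?_, fun j => ?_⟩
  · rw [Function.onFun, hX, hX, Set.disjoint_left]
    rintro _ ⟨i, rfl, rfl⟩ ⟨i', rfl, h⟩
    rw [add_right_inj, natCast_mul_natCast_eq_iff hr] at h
    exact hjk (natCast_div_eq_of_modEq h)
  · ext x
    simp only [Set.mem_iUnion, hX, oneAddRZ, Set.mem_ofPred_eq]
    constructor
    · rintro ⟨_, i, -, rfl⟩
      exact ⟨i, by ring⟩
    · rintro ⟨k, rfl⟩
      exact ⟨_, k.val, rfl, by rw [ZMod.natCast_zmod_val]; ring⟩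
  · simp [hq1]
  · rw [hX, hX, hs, Int.cast_natCast]
    ext x
    constructor
    · rintro ⟨_, ⟨i, rfl, rfl⟩, rfl⟩
      refine ⟨i + b, ?_, one_add_mul_one_add_mul i⟩
      rw [Nat.add_div_right _ hb, Nat.cast_succ]
    · rintro ⟨i, hi, rfl⟩
      refine ⟨_, ⟨i + b * (p - 1), ?_, rfl⟩, ?_⟩
      · rw [Nat.add_mul_div_left _ _ hb, Nat.cast_add, hi, Nat.cast_sub hp.one_lt.le]
        simp
      · refine (one_add_mul_one_add_mul _).trans ?_
        rw [add_right_inj, natCast_mul_natCast_eq_iff hr]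
        obtain ⟨c, rfl⟩ : ∃ c, p = c + 1 := ⟨p - 1, by have := hp.pos; omega⟩
        have h : i + b * (c + 1 - 1) + b = i + (c + 1) * b := by
          rw [Nat.add_sub_cancel]
          ring
        rw [h]
        exact Nat.add_modEq_right
end

section
/- Let p be a prime, let q be a prime power with ν_p(q−1) ≥ 2, and let n, r be positive integers with rn dividing q−1, ν_p(r) ≥ 1 and ν_p(n) ≥ 1. Let F_q be the finite field with q elements, let ω ∈ F_q be a primitive rn-th root of unity, and let k be an integer with 0 < k < p. Then the following two subsets of the polynomial ring F_q[X] are equal: A = { Σ_{t=0}^{n−1} ω^{−t} · f(ω^{−rt}) · X^t : f ∈ F_q[X] with deg f < kn/p } and B = { c ∈ F_q[X] : deg c < n and c(ω^{1+ir}) = 0 for every integer i with kn/p ≤ i < n }. Moreover, A is an F_q-subspace of dimension kn/p, and every nonzero c ∈ A has at least (p−k)n/p + 1 nonzero coefficients (so the corresponding code is an MDS code with parameters [n, kn/p, (p−k)n/p + 1]). -/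
open Polynomial in
/-- The generalized Reed-Solomon encoder with locators `(ζ⁻¹)ᵗ` and multipliers `(v⁻¹)ᵗ`,
`t < n`, with codewords written as polynomials. -/
noncomputable def grsEncode {F : Type*} [Field F] (n : ℕ) (v ζ : F) : F[X] →ₗ[F] F[X] :=
  ∑ t ∈ Finset.range n, (v⁻¹ ^ t) • (monomial t ∘ₗ leval (ζ⁻¹ ^ t))

section GRS

open Polynomial

variable {F : Type*} [Field F] {n : ℕ} {v ζ : F}

theorem grsEncode_apply (f : F[X]) :
    grsEncode n v ζ f =
      ∑ t ∈ Finset.range n, C (v⁻¹ ^ t * eval (ζ⁻¹ ^ t) f) * X ^ t := by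
  simp only [C_mul_X_pow_eq_monomial]
  simp [grsEncode, LinearMap.sum_apply, smul_monomial]

theorem coeff_grsEncode (f : F[X]) {t : ℕ} (ht : t < n) :
    (grsEncode n v ζ f).coeff t = v⁻¹ ^ t * eval (ζ⁻¹ ^ t) f := by
  rw [grsEncode_apply, finsetSum_coeff]
  simp_rw [coeff_C_mul_X_pow]
  simp [ht]

theorem degree_grsEncode_lt (f : F[X]) : (grsEncode n v ζ f).degree < (n : WithBot ℕ) := by
  rw [grsEncode_apply, ← mem_degreeLT]
  refine Submodule.sum_mem _ fun t ht => mem_degreeLT.2 ?_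
  refine (degree_C_mul_X_pow_le t _).trans_lt ?_
  exact_mod_cast Finset.mem_range.1 ht

theorem IsPrimitiveRoot.sum_pow_mul_inv_pow (hζ : IsPrimitiveRoot ζ n) {i j : ℕ} (hi : i < n)
    (hj : j < n) :
    ∑ t ∈ Finset.range n, (ζ ^ i * ζ⁻¹ ^ j) ^ t = if i = j then (n : F) else 0 := by
  have hζ0 : ζ ≠ 0 := hζ.ne_zero (by omega)
  split_ifs with h
  · subst h
    simp [hζ0]
  · have hne : ζ ^ i * ζ⁻¹ ^ j ≠ 1 := by
      rw [inv_pow, ← div_eq_mul_inv, Ne, div_eq_one_iff_eq (pow_ne_zero _ hζ0)]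
      exact fun h' => h (hζ.pow_inj hi hj h')
    have hpow : (ζ ^ i * ζ⁻¹ ^ j) ^ n = 1 := by
      rw [mul_pow, pow_right_comm, pow_right_comm ζ⁻¹, inv_pow, hζ.pow_eq_one]
      simp
    rw [geom_sum_eq hne, hpow]
    simp

/-- Evaluating a codeword at `v ζⁱ` inverts the encoder up to the factor `n`. -/
theorem eval_grsEncode (hζ : IsPrimitiveRoot ζ n) (hv : v ≠ 0) {f : F[X]}
    (hf : f.degree < (n : WithBot ℕ)) {i : ℕ} (hi : i < n) :
    eval (v * ζ ^ i) (grsEncode n v ζ f) = n * f.coeff i := by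
  have hfn : f.natDegree < n := by
    rcases eq_or_ne f 0 with rfl | h0
    · simpa using by omega
    · exact (natDegree_lt_iff_degree_lt h0).2 hf
  have hterm : ∀ t, v⁻¹ ^ t * eval (ζ⁻¹ ^ t) f * (v * ζ ^ i) ^ t =
      ∑ j ∈ Finset.range n, f.coeff j * (ζ ^ i * ζ⁻¹ ^ j) ^ t := by
    intro t
    rw [eval_eq_sum_range' hfn, Finset.mul_sum, Finset.sum_mul]
    refine Finset.sum_congr rfl fun j _ => ?_
    have hvt : v⁻¹ ^ t * v ^ t = 1 := by rw [← mul_pow, inv_mul_cancel₀ hv, one_pow]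
    rw [mul_pow, mul_pow, pow_right_comm ζ⁻¹ t j]
    linear_combination (f.coeff j * (ζ⁻¹ ^ j) ^ t * (ζ ^ i) ^ t) * hvt
  rw [grsEncode_apply, eval_finsetSum]
  simp_rw [eval_mul, eval_C, eval_pow, eval_X, hterm]
  rw [Finset.sum_comm]
  simp_rw [← Finset.mul_sum]
  rw [Finset.sum_congr rfl fun j hj => by
    rw [hζ.sum_pow_mul_inv_pow hi (Finset.mem_range.1 hj)]]
  simp [hi, mul_comm]

theorem eq_of_eval_mul_pow_eq (hζ : IsPrimitiveRoot ζ n) (hv : v ≠ 0) {c d : F[X]}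
    (hc : c.degree < (n : WithBot ℕ)) (hd : d.degree < (n : WithBot ℕ))
    (h : ∀ i < n, eval (v * ζ ^ i) c = eval (v * ζ ^ i) d) : c = d := by
  refine eq_of_degrees_lt_of_eval_index_eq (Finset.range n) (v := fun i => v * ζ ^ i) ?_
    (by simpa using hc) (by simpa using hd) fun i hi => h i (Finset.mem_range.1 hi)
  intro i hi j hj hij
  exact hζ.pow_inj (by simpa using hi) (by simpa using hj) (mul_left_cancel₀ hv hij)

theorem map_grsEncode_degreeLT (hζ : IsPrimitiveRoot ζ n) (hv : v ≠ 0) (hn : (n : F) ≠ 0)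
    {K : ℕ} (hK : K ≤ n) :
    ((degreeLT F K).map (grsEncode n v ζ) : Set F[X]) =
      {c | c.degree < (n : WithBot ℕ) ∧ ∀ i, K ≤ i → i < n → eval (v * ζ ^ i) c = 0} := by
  have hKn : (K : WithBot ℕ) ≤ n := by exact_mod_cast hK
  ext c
  constructor
  · rintro ⟨f, hf, rfl⟩
    have hf := mem_degreeLT.1 hf
    refine ⟨degree_grsEncode_lt f, fun i hKi hi => ?_⟩
    rw [eval_grsEncode hζ hv (hf.trans_le hKn) hi,
      coeff_eq_zero_of_degree_lt (hf.trans_le (by exact_mod_cast hKi)), mul_zero]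
  · rintro ⟨hc, hroot⟩
    set f : F[X] := ∑ i ∈ Finset.range K, C ((n : F)⁻¹ * eval (v * ζ ^ i) c) * X ^ i with hfdef
    have hf : f ∈ degreeLT F K := by
      refine Submodule.sum_mem _ fun i hi => mem_degreeLT.2 ?_
      refine (degree_C_mul_X_pow_le i _).trans_lt ?_
      exact_mod_cast Finset.mem_range.1 hi
    refine ⟨f, hf, eq_of_eval_mul_pow_eq hζ hv (degree_grsEncode_lt f) hc fun i hi => ?_⟩
    rw [eval_grsEncode hζ hv ((mem_degreeLT.1 hf).trans_le hKn) hi, hfdef, finsetSum_coeff]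
    simp_rw [coeff_C_mul_X_pow]
    rcases lt_or_ge i K with h | h
    · simp [h, hn]
    · simp [h.not_gt, hroot i h hi]

theorem finrank_map_grsEncode_degreeLT (hζ : IsPrimitiveRoot ζ n) (hv : v ≠ 0)
    (hn : (n : F) ≠ 0) {K : ℕ} (hK : K ≤ n) :
    Module.finrank F ((degreeLT F K).map (grsEncode n v ζ)) = K := by
  have hKn : (K : WithBot ℕ) ≤ n := by exact_mod_cast hK
  have hinj : Function.Injective ((grsEncode n v ζ).domRestrict (degreeLT F K)) := by
    refine (injective_iff_map_eq_zero _).2 fun ⟨f, hf⟩ h => Subtype.ext (Polynomial.ext fun i => ?_)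
    have hf := mem_degreeLT.1 hf
    rcases lt_or_ge i n with hi | hi
    · have := eval_grsEncode hζ hv (hf.trans_le hKn) hi
      rw [LinearMap.domRestrict_apply] at h
      simpa [h, hn] using this
    · exact coeff_eq_zero_of_degree_lt ((hf.trans_le hKn).trans_le (by exact_mod_cast hi))
  rw [← LinearMap.range_domRestrict, LinearMap.finrank_range_of_inj hinj,
    (degreeLTEquiv F K).finrank_eq, Module.finrank_fin_fun]

theorem lt_card_support_grsEncode_add (hζ : IsPrimitiveRoot ζ n) (hv : v ≠ 0) {K : ℕ}
    {f : F[X]} (hf : f.degree < (K : WithBot ℕ)) (h0 : grsEncode n v ζ f ≠ 0) :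
    n < (grsEncode n v ζ f).support.card + K := by
  have hf0 : f ≠ 0 := by
    rintro rfl
    simp at h0
  have hcard : (Finset.range n \ (grsEncode n v ζ f).support).card < K := by
    by_contra! hle
    refine hf0 (eq_zero_of_degree_lt_of_eval_index_eq_zero
      (Finset.range n \ (grsEncode n v ζ f).support) (v := fun t => ζ⁻¹ ^ t) ?_
      (hf.trans_le (by exact_mod_cast hle)) ?_)
    · intro i hi j hj hij
      simp only [Finset.coe_sdiff, Set.mem_sdiff, Finset.mem_coe, Finset.mem_range] at hi hj
      exact hζ.inv.pow_inj hi.1 hj.1 hij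
    · intro t ht
      obtain ⟨ht, hs⟩ := Finset.mem_sdiff.1 ht
      rw [notMem_support_iff, coeff_grsEncode f (Finset.mem_range.1 ht)] at hs
      exact (mul_eq_zero.1 hs).resolve_left (pow_ne_zero _ (inv_ne_zero hv))
  have := Finset.le_card_sdiff (grsEncode n v ζ f).support (Finset.range n)
  rw [Finset.card_range] at this
  omega

end GRS

/-- GRS codes from Type I `p`-adic constacyclic codes.
Let `p` be prime, `q` a prime power with `ν_p(q-1) ≥ 2`, `n`, `r` positive with
`rn ∣ q-1`, `ν_p(r) ≥ 1`, `ν_p(n) ≥ 1`; let `F` be the field with `q` elements,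
`ω ∈ F` a primitive `rn`-th root of unity and `0 < k < p`.  Then the GRS code
`A = {∑_{t<n} ω^{-t} f(ω^{-rt}) X^t : deg f < kn/p}` (in polynomial form) equals
the constacyclic code
`B = {c : deg c < n, c(ω^{1+ir}) = 0 for kn/p ≤ i < n}`; moreover `A` is an
`F`-subspace of dimension `kn/p` and every nonzero element of `A` has at least
`(p-k)n/p + 1` nonzero coefficients, so the code is MDS with parameters
`[n, kn/p, (p-k)n/p + 1]`. -/
theorem grs_eq_constacyclic_and_mds (p : ℕ) (hp : p.Prime) (q : ℕ)
    (hq : IsPrimePow q) (hqv : 2 ≤ (q - 1).factorization p)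
    (n r : ℕ) (hn : 0 < n) (hr : 0 < r) (hdvd : r * n ∣ q - 1)
    (hrv : 1 ≤ r.factorization p) (hnv : 1 ≤ n.factorization p)
    (F : Type*) [Field F] [Fintype F] (hF : Fintype.card F = q)
    (ω : F) (hω : IsPrimitiveRoot ω (r * n))
    (k : ℕ) (hk0 : 0 < k) (hkp : k < p)
    (A B : Set (Polynomial F))
    (hA : A = {c | ∃ f : Polynomial F,
        f.degree < ((k * n / p : ℕ) : WithBot ℕ) ∧
        c = ∑ t ∈ Finset.range n,
          Polynomial.C (ω⁻¹ ^ t * Polynomial.eval (ω⁻¹ ^ (r * t)) f) *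
            Polynomial.X ^ t})
    (hB : B = {c | c.degree < ((n : ℕ) : WithBot ℕ) ∧
        ∀ i : ℕ, k * n / p ≤ i → i < n → Polynomial.eval (ω ^ (1 + i * r)) c = 0}) :
    A = B ∧
    (∃ S : Submodule F (Polynomial F), (S : Set (Polynomial F)) = A ∧
      Module.finrank F ↥S = k * n / p) ∧
    (∀ c ∈ A, c ≠ 0 → (p - k) * n / p + 1 ≤ c.support.card) := by
  have hω0 : ω ≠ 0 := hω.ne_zero (by positivity)
  have hζ : IsPrimitiveRoot (ω ^ r) n := hω.pow (by positivity) rfl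
  have hnF : (n : F) ≠ 0 := by
    have : NeZero n := ⟨hn.ne'⟩
    exact hζ.neZero'.out
  have hpn : p ∣ n := Nat.dvd_of_factorization_pos (by omega)
  obtain ⟨m, rfl⟩ := hpn
  have hdiv (a : ℕ) : a * (p * m) / p = a * m := by
    rw [mul_left_comm, Nat.mul_div_cancel_left _ hp.pos]
  rw [hdiv] at *
  have hK : k * m ≤ p * m := Nat.mul_le_mul_right m hkp.le
  have hAS : ((Polynomial.degreeLT F (k * m)).map (grsEncode (p * m) ω (ω ^ r)) :
      Set (Polynomial F)) = A := by
    ext c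
    simp only [hA, SetLike.mem_coe, Submodule.mem_map, Polynomial.mem_degreeLT, grsEncode_apply,
      Set.mem_ofPred_eq, ← inv_pow, ← pow_mul, eq_comm]
  refine ⟨?_, ⟨_, hAS, finrank_map_grsEncode_degreeLT hζ hω0 hnF hK⟩, ?_⟩
  · rw [← hAS, map_grsEncode_degreeLT hζ hω0 hnF hK, hB]
    simp only [pow_add, pow_one, mul_comm _ r, pow_mul]
  · rw [← hAS, hdiv, Nat.sub_mul]
    rintro _ ⟨f, hf, rfl⟩ h0
    have := lt_card_support_grsEncode_add hζ hω0 (Polynomial.mem_degreeLT.1 hf) h0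
    omega
end

section
/- Let q be an odd prime power, let ℓ be an odd positive divisor of q+1, and set n = (q+1)/ℓ (so n is even). In Z_{2n}, let X_0 = {1, 3, 5, ..., n−1} (the odd residues less than n) and X_1 = {n+1, n+3, ..., 2n−1}. Then X_0 and X_1 are disjoint with union equal to 1+2Z_{2n} (the odd residues modulo 2n), μ_q(X_0) = X_0, μ_q(X_1) = X_1, μ_{−1}(X_0) = X_1 and μ_{−1}(X_1) = X_0; that is, {X_0, X_1} is a Type I duadic splitting of 1+2Z_{2n} given by the multiplier μ_{−1}. -/
/-- A map that sends `A` into `B` and `B` into `A`, and squares to the identity on `B`,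
maps `A` onto `B`. -/
theorem Set.image_eq_of_mapsTo_of_comp_self {α : Type*} {f : α → α} {A B : Set α}
    (hAB : Set.MapsTo f A B) (hBA : Set.MapsTo f B A) (hf : ∀ x ∈ B, f (f x) = x) :
    f '' A = B :=
  Set.Subset.antisymm hAB.image_subset fun x hx => ⟨f x, hBA hx, hf x hx⟩

/-- Multiplication by `q` reflects odd residues modulo `2 * n` when `q + 1` is an odd
multiple of `n`. -/
theorem ZMod.mul_natCast_eq_sub_of_odd {q ℓ n i : ℕ} (h : q + 1 = n * ℓ) (hl : Odd ℓ)
    (hi : Odd i) : (q : ZMod (2 * n)) * i = n - i := by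
  obtain ⟨k, hk⟩ := hl.mul hi
  have h2n : (2 * n : ZMod (2 * n)) = 0 := by exact_mod_cast ZMod.natCast_self (2 * n)
  have hq : (q : ZMod (2 * n)) + 1 = n * ℓ := by exact_mod_cast congrArg Nat.cast h
  have hk' : (ℓ : ZMod (2 * n)) * i = 2 * k + 1 := by exact_mod_cast congrArg Nat.cast hk
  linear_combination (i : ZMod (2 * n)) * hq + (n : ZMod (2 * n)) * hk' + k * h2n


/-- Proposition: explicit duadic splitting for negacyclic
codes.  Let `q` be an odd prime power, `ℓ` an odd positive divisor of `q+1`,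
and `n = (q+1)/ℓ`.  In `Z_{2n}`, let `X0 = {1, 3, …, n-1}` and
`X1 = {n+1, n+3, …, 2n-1}`.  Then `X0`, `X1` are disjoint with union the set of
odd residues `1 + 2·Z_{2n}`, each is invariant under `μ_q : x ↦ qx`, and
`μ_{-1} : x ↦ -x` interchanges them; i.e. `{X0, X1}` is a Type I duadic
splitting of `1 + 2·Z_{2n}` given by `μ_{-1}`. -/
theorem explicit_duadic_negacyclic_splitting (q ℓ : ℕ) (hq : IsPrimePow q)
    (hqodd : Odd q) (hlodd : Odd ℓ) (hl0 : 0 < ℓ) (hld : ℓ ∣ q + 1)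
    (n : ℕ) (hn : n = (q + 1) / ℓ)
    (X0 X1 : Set (ZMod (2 * n)))
    (hX0 : X0 = {x | ∃ i : ℕ, Odd i ∧ i < n ∧ x = (i : ZMod (2 * n))})
    (hX1 : X1 = {x | ∃ i : ℕ, Odd i ∧ n ≤ i ∧ i < 2 * n ∧ x = (i : ZMod (2 * n))}) :
    Disjoint X0 X1 ∧
    X0 ∪ X1 = {x : ZMod (2 * n) | ∃ k : ZMod (2 * n), x = 1 + 2 * k} ∧
    (fun x => (q : ZMod (2 * n)) * x) '' X0 = X0 ∧
    (fun x => (q : ZMod (2 * n)) * x) '' X1 = X1 ∧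
    (fun x => -x) '' X0 = X1 ∧
    (fun x => -x) '' X1 = X0 := by
  have hqn : q + 1 = n * ℓ := by rw [hn, Nat.div_mul_cancel hld]
  have hn0 : 0 < n := by
    rcases Nat.eq_zero_or_pos n with h | h
    · simp [h] at hqn
    · exact h
  have hne : Even n := by
    have h : Even (n * ℓ) := hqn ▸ hqodd.add_one
    exact (Nat.even_mul.mp h).resolve_right (Nat.not_even_iff_odd.mpr hlodd)
  have : NeZero (2 * n) := ⟨by omega⟩
  have h2n : (2 * n : ZMod (2 * n)) = 0 := by exact_mod_cast ZMod.natCast_self (2 * n)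
  obtain ⟨m, hm⟩ := hne
  have hneg01 : Set.MapsTo (fun x => -x) X0 X1 := by
    subst hX0 hX1
    rintro _ ⟨i, ⟨k, hk⟩, hin, rfl⟩
    refine ⟨2 * n - i, ⟨n - k - 1, by omega⟩, by omega, by omega, ?_⟩
    push_cast [Nat.cast_sub (show i ≤ 2 * n by omega)]
    linear_combination -h2n
  have hneg10 : Set.MapsTo (fun x => -x) X1 X0 := by
    subst hX0 hX1
    rintro _ ⟨i, ⟨k, hk⟩, hni, hin, rfl⟩
    refine ⟨2 * n - i, ⟨n - k - 1, by omega⟩, by omega, ?_⟩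
    push_cast [Nat.cast_sub (show i ≤ 2 * n by omega)]
    linear_combination -h2n
  have hq0 : Set.MapsTo (fun x => (q : ZMod (2 * n)) * x) X0 X0 := by
    subst hX0
    rintro _ ⟨i, hi, hin, rfl⟩
    have hqi := ZMod.mul_natCast_eq_sub_of_odd hqn hlodd hi
    obtain ⟨k, hk⟩ := hi
    refine ⟨n - i, ⟨m - k - 1, by omega⟩, by omega, ?_⟩
    rw [Nat.cast_sub hin.le]
    exact hqi
  have hq1 : Set.MapsTo (fun x => (q : ZMod (2 * n)) * x) X1 X1 := by
    subst hX1
    rintro _ ⟨i, hi, hni, hin, rfl⟩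
    have hqi := ZMod.mul_natCast_eq_sub_of_odd hqn hlodd hi
    obtain ⟨k, hk⟩ := hi
    refine ⟨3 * n - i, ⟨3 * m - k - 1, by omega⟩, by omega, by omega, ?_⟩
    push_cast [Nat.cast_sub (show i ≤ 3 * n by omega)]
    linear_combination hqi - h2n
  have hqq : (q : ZMod (2 * n)) * q = 1 := by
    have h := ZMod.mul_natCast_eq_sub_of_odd hqn hlodd hqodd
    have h1 := ZMod.mul_natCast_eq_sub_of_odd hqn hlodd odd_one
    push_cast at h1
    linear_combination h - h1
  have hinv : ∀ x : ZMod (2 * n), (q : ZMod (2 * n)) * (q * x) = x := fun x => by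
    rw [← mul_assoc, hqq, one_mul]
  refine ⟨?_, ?_, Set.image_eq_of_mapsTo_of_comp_self hq0 hq0 fun x _ => hinv x,
    Set.image_eq_of_mapsTo_of_comp_self hq1 hq1 fun x _ => hinv x,
    Set.image_eq_of_mapsTo_of_comp_self hneg01 hneg10 fun x _ => neg_neg x,
    Set.image_eq_of_mapsTo_of_comp_self hneg10 hneg01 fun x _ => neg_neg x⟩
  · subst hX0 hX1
    rw [Set.disjoint_left]
    rintro _ ⟨i, -, hin, rfl⟩ ⟨j, -, hnj, hjn, hij⟩
    have h := (ZMod.natCast_eq_natCast_iff' _ _ _).mp hij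
    rw [Nat.mod_eq_of_lt (by omega), Nat.mod_eq_of_lt hjn] at h
    omega
  · subst hX0 hX1
    ext x
    constructor
    · rintro (⟨i, ⟨k, rfl⟩, -, rfl⟩ | ⟨i, ⟨k, rfl⟩, -, -, rfl⟩) <;>
        exact ⟨k, by push_cast; ring⟩
    · rintro ⟨k, rfl⟩
      have hcast : (1 + 2 * k : ZMod (2 * n)) = ((1 + 2 * k.val) % (2 * n) : ℕ) := by
        rw [ZMod.natCast_mod]
        simp
      have hodd : Odd ((1 + 2 * k.val) % (2 * n)) := by
        rw [Nat.odd_iff, Nat.mod_mod_of_dvd _ (Dvd.intro n rfl)]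
        omega
      have hlt : (1 + 2 * k.val) % (2 * n) < 2 * n := Nat.mod_lt _ (by omega)
      rcases lt_or_ge ((1 + 2 * k.val) % (2 * n)) n with h | h
      · exact Or.inl ⟨_, hodd, h, hcast⟩
      · exact Or.inr ⟨_, hodd, h, hlt, hcast⟩
end

section
/- Let q be an odd prime power with ν₂(q−1) ≥ 3. Set r = (q−1)/2, n = q+1, s = 1 + (q²−1)/4, so that rn = (q²−1)/2. In Z_{rn}, let X_0 = { 1 + ((q−1)/2)·j mod rn : j integer with −(q−1)/4 < j ≤ (q−1)/4 + 1 } and X_1 = (1+rZ_{rn}) \ X_0. Then: (1) X_0 ⊆ 1+rZ_{rn} and μ_q(X_0) = X_0 (so X_0 is a union of q-cyclotomic cosets modulo rn); (2) |X_0| = (q+1)/2; (3) μ_s(X_0) ∩ X_0 = ∅. Consequently {X_0, X_1} is a Type I duadic splitting of 1+rZ_{rn} given by the multiplier μ_s. -/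
/-- The parametrization `j ↦ 1 + r·j` of `1 + r·Z_{rn}` identifies exactly the integers
congruent modulo `n`. -/
lemma one_add_mul_intCast_eq_iff {r n : ℕ} (hr : 0 < r) (i j : ℤ) :
    (1 + (r : ZMod (r * n)) * (i : ZMod (r * n)) = 1 + (r : ZMod (r * n)) * (j : ZMod (r * n))) ↔
      (n : ℤ) ∣ i - j := by
  have hr' : (r : ℤ) ≠ 0 := by exact_mod_cast hr.ne'
  rw [add_right_inj, eq_comm, ← mul_dvd_mul_iff_left hr', mul_sub]
  have h := ZMod.intCast_eq_intCast_iff_dvd_sub ((r : ℤ) * j) (r * i) (r * n)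
  push_cast at h
  exact h

/-- Every element of `1 + r·Z_{rn}` is `1 + r·j` with `j` in a prescribed window of length `n`. -/
lemma mem_oneAddRZ_iff_exists_window {r n : ℕ} (hr : 0 < r) (hn : 0 < n) (a : ℤ)
    (x : ZMod (r * n)) :
    x ∈ oneAddRZ n r ↔
      ∃ j : ℤ, a ≤ j ∧ j < a + n ∧ x = 1 + (r : ZMod (r * n)) * (j : ZMod (r * n)) := by
  constructor
  · rintro ⟨k, rfl⟩
    obtain ⟨k, rfl⟩ := ZMod.intCast_surjective k
    have hn' : (0 : ℤ) < n := by exact_mod_cast hn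
    refine ⟨a + (k - a) % n, ?_, ?_, ?_⟩
    · linarith [Int.emod_nonneg (k - a) hn'.ne']
    · linarith [Int.emod_lt_of_pos (k - a) hn']
    · rw [one_add_mul_intCast_eq_iff hr, ← sub_sub]
      exact Int.dvd_self_sub_emod
  · rintro ⟨j, -, -, rfl⟩
    exact ⟨j, rfl⟩

/-- Proposition: explicit duadic constacyclic splitting.
Let `q` be an odd prime power with `ν₂(q-1) ≥ 3`, and set `r = (q-1)/2`,
`n = q+1`, `s = 1 + (q²-1)/4` (so `rn = (q²-1)/2`).  With
`X0 = {1 + r·j mod rn : -(q-1)/4 < j ≤ (q-1)/4 + 1}` and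
`X1 = (1 + r·Z_{rn}) \ X0`, we have: (1) `X0 ⊆ 1 + r·Z_{rn}` and
`μ_q(X0) = X0`; (2) `|X0| = (q+1)/2`; (3) `μ_s(X0) ∩ X0 = ∅`; and consequently
`{X0, X1}` is a Type I duadic splitting of `1 + r·Z_{rn}` given by `μ_s`. -/
theorem explicit_duadic_constacyclic_splitting (q : ℕ) (hq : IsPrimePow q)
    (hqodd : Odd q) (hqv : 3 ≤ (q - 1).factorization 2)
    (r n s : ℕ) (hr : r = (q - 1) / 2) (hn : n = q + 1)
    (hs : s = 1 + (q ^ 2 - 1) / 4)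
    (X0 X1 : Set (ZMod (r * n)))
    (hX0 : X0 = {x | ∃ j : ℤ, -(((q : ℤ) - 1) / 4) < j ∧ j ≤ ((q : ℤ) - 1) / 4 + 1 ∧
        x = 1 + (r : ZMod (r * n)) * ((j : ℤ) : ZMod (r * n))})
    (hX1 : X1 = oneAddRZ n r \ X0) :
    (X0 ⊆ oneAddRZ n r ∧ (fun x => (q : ZMod (r * n)) * x) '' X0 = X0) ∧
    Nat.card X0 = (q + 1) / 2 ∧
    ((fun x => (s : ZMod (r * n)) * x) '' X0) ∩ X0 = ∅ ∧
    (Disjoint X0 X1 ∧ X0 ∪ X1 = oneAddRZ n r ∧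
      (fun x => (q : ZMod (r * n)) * x) '' X1 = X1 ∧
      (fun x => (s : ZMod (r * n)) * x) '' X0 = X1 ∧
      (fun x => (s : ZMod (r * n)) * x) '' X1 = X0) := by
  have h8 : 8 ∣ q - 1 :=
    (pow_dvd_pow 2 hqv).trans (Nat.ordProj_dvd (q - 1) 2)
  have hq1 := hq.one_lt
  obtain ⟨m, hm⟩ := h8
  obtain rfl : q = 8 * m + 1 := by omega
  have hm0 : 0 < m := by omega
  obtain rfl : r = 4 * m := by omega
  obtain rfl : n = 8 * m + 2 := by omega
  have hs' : s = 1 + 4 * m * (4 * m + 1) := by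
    have : (8 * m + 1) ^ 2 - 1 = 4 * (4 * m * (4 * m + 1)) := by
      rw [Nat.sub_eq_iff_eq_add (Nat.one_le_pow _ _ (by omega))]; ring
    omega
  clear hs hr hn hm hqv hqodd hq hq1
  have hr0 : 0 < 4 * m := by omega
  set f : ℤ → ZMod (4 * m * (8 * m + 2)) :=
    fun j => 1 + ((4 * m : ℕ) : ZMod (4 * m * (8 * m + 2))) * (j : ZMod (4 * m * (8 * m + 2)))
    with hf
  have hfeq : ∀ i j, f i = f j ↔ (8 * m + 2 : ℤ) ∣ i - j := fun i j => by
    have h := one_add_mul_intCast_eq_iff (n := 8 * m + 2) hr0 i j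
    rwa [show ((8 * m + 2 : ℕ) : ℤ) = 8 * m + 2 by push_cast; rfl] at h
  have hN : (4 * m * (8 * m + 2) : ZMod (4 * m * (8 * m + 2))) = 0 := by
    exact_mod_cast ZMod.natCast_self (4 * m * (8 * m + 2))
  have hY0 : X0 = f '' Set.Icc (1 - 2 * m : ℤ) (2 * m + 1) := by
    rw [hX0]
    ext x
    simp only [Set.mem_ofPred_eq, Set.mem_image, Set.mem_Icc]
    constructor
    · rintro ⟨j, h1, h2, rfl⟩
      exact ⟨j, by push_cast at h1 h2; omega, rfl⟩
    · rintro ⟨j, h, rfl⟩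
      exact ⟨j, by push_cast; omega, by push_cast; omega, rfl⟩
  have hA : oneAddRZ (8 * m + 2) (4 * m) = f '' Set.Icc (1 - 2 * m : ℤ) (6 * m + 2) := by
    ext x
    rw [mem_oneAddRZ_iff_exists_window hr0 (by omega) (1 - 2 * m : ℤ)]
    simp only [Set.mem_image, Set.mem_Icc]
    constructor
    · rintro ⟨j, h1, h2, rfl⟩
      exact ⟨j, by push_cast at h2; omega, rfl⟩
    · rintro ⟨j, h, rfl⟩
      exact ⟨j, h.1, by push_cast; omega, rfl⟩
  have hinj : Set.InjOn f (Set.Icc (1 - 2 * m : ℤ) (6 * m + 2)) := by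
    intro i hi j hj h
    obtain ⟨hi1, hi2⟩ := hi
    obtain ⟨hj1, hj2⟩ := hj
    have h := Int.eq_zero_of_abs_lt_dvd ((hfeq i j).1 h) (by rw [abs_lt]; constructor <;> linarith)
    linarith
  have hsub : Set.Icc (1 - 2 * m : ℤ) (2 * m + 1) ⊆ Set.Icc (1 - 2 * m : ℤ) (6 * m + 2) :=
    Set.Icc_subset_Icc_right (by omega)
  have hY1 : X1 = f '' Set.Icc (2 * m + 2 : ℤ) (6 * m + 2) := by
    rw [hX1, hA, hY0, ← hinj.image_sdiff_subset hsub]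
    congr 1
    ext j
    simp only [Set.mem_sdiff, Set.mem_Icc]
    omega
  have hqf : ∀ j, ((8 * m + 1 : ℕ) : ZMod (4 * m * (8 * m + 2))) * f j = f (2 - j) := fun j => by
    simp only [hf]
    push_cast
    linear_combination (j : ZMod (4 * m * (8 * m + 2))) * hN
  have hsf : ∀ j, (s : ZMod (4 * m * (8 * m + 2))) * f j = f (j + (4 * m + 1)) := fun j => by
    simp only [hf, hs']
    push_cast
    linear_combination (2 * m * j : ZMod (4 * m * (8 * m + 2))) * hN
  have hper : ∀ j, f (j + (8 * m + 2)) = f j := fun j => by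
    rw [hfeq]; simp
  have hdisj : Disjoint X0 X1 := by
    rw [hX1]; exact Set.disjoint_sdiff_right
  have hX0A : X0 ⊆ oneAddRZ (8 * m + 2) (4 * m) := by
    rw [hY0, hA]; exact Set.image_mono hsub
  have hs0 : (fun x => (s : ZMod (4 * m * (8 * m + 2))) * x) '' X0 = X1 := by
    rw [hY0, hY1, Set.image_image]
    simp only [hsf]
    rw [← Set.image_image f (fun j => j + (4 * m + 1 : ℤ)), Set.image_add_const_Icc]
    congr 2 <;> ring
  have hs1 : (fun x => (s : ZMod (4 * m * (8 * m + 2))) * x) '' X1 = X0 := by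
    rw [hY0, hY1, Set.image_image]
    simp only [hsf]
    have : ∀ j : ℤ, f (j + (4 * m + 1)) = f (j - (4 * m + 1)) := fun j => by
      rw [← hper (j - _)]; congr 1; ring
    simp only [this]
    rw [← Set.image_image f (fun j => j - (4 * m + 1 : ℤ)), Set.image_sub_const_Icc]
    congr 2 <;> ring
  refine ⟨⟨hX0A, ?_⟩, ?_, ?_, hdisj, ?_, ?_, hs0, hs1⟩
  · rw [hY0, Set.image_image]
    simp only [hqf]
    rw [← Set.image_image f (fun j => (2 : ℤ) - j), Set.image_const_sub_Icc]
    congr 2 <;> ring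
  · rw [hY0, Nat.card_image_of_injOn (hinj.mono hsub)]
    simp
    omega
  · rw [hs0]; exact hdisj.symm.inter_eq
  · rw [hX1]; exact Set.union_sdiff_cancel hX0A
  · rw [hY1, Set.image_image]
    simp only [hqf]
    have : ∀ j : ℤ, f (2 - j) = f ((8 * m + 4) - j) := fun j => by
      rw [← hper (2 - j)]; congr 1; ring
    simp only [this]
    rw [← Set.image_image f (fun j => (8 * m + 4 : ℤ) - j), Set.image_const_sub_Icc]
    congr 2 <;> ring
end
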